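/- arXiv:2010.09231 — 3 statements merged into one kernel-verified Lean document; each statement's English description precedes it below -/
import Mathlib

section
/- Let θ ∈ (0, π), r > 0, w > 0 with 3w/2 ≤ r, and let Δh satisfy 0 < Δh ≤ √(r² − (3w/2)²) − (3w/2)·cot(θ/2). Then for every horizontal offset d with 0 ≤ d ≤ 3w/2 and every depth z with (3w/2)·cot(θ/2) ≤ z ≤ (3w/2)·cot(θ/2) + Δh, the point at horizontal distance d and depth z below the sensor is covered: d ≤ z·tan(θ/2) and d² + z² ≤ r². -/
open Real

/-- With `θ ∈ (0, π)`, `r > 0`, `w > 0`, `3w/2 ≤ r` and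
`0 < Δh ≤ √(r² − (3w/2)²) − (3w/2)·cot(θ/2)`, every point at horizontal offset
`0 ≤ d ≤ 3w/2` and depth `z ∈ [(3w/2)·cot(θ/2), (3w/2)·cot(θ/2) + Δh]` is covered
by the sensor: `d ≤ z·tan(θ/2)` and `d² + z² ≤ r²`. -/
theorem covered_band (θ r w Δh d z : ℝ) (hθ : θ ∈ Set.Ioo 0 π) (hr : 0 < r)
    (hw : 0 < w) (hwr : 3 * w / 2 ≤ r)
    (hΔh0 : 0 < Δh)
    (hΔh : Δh ≤ Real.sqrt (r ^ 2 - (3 * w / 2) ^ 2)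
            - (3 * w / 2) * (Real.cos (θ / 2) / Real.sin (θ / 2)))
    (hd0 : 0 ≤ d) (hd : d ≤ 3 * w / 2)
    (hz1 : (3 * w / 2) * (Real.cos (θ / 2) / Real.sin (θ / 2)) ≤ z)
    (hz2 : z ≤ (3 * w / 2) * (Real.cos (θ / 2) / Real.sin (θ / 2)) + Δh) :
    d ≤ z * Real.tan (θ / 2) ∧ d ^ 2 + z ^ 2 ≤ r ^ 2 := by
  obtain ⟨h0, hpi⟩ := hθ
  have hs : 0 < Real.sin (θ / 2) := Real.sin_pos_of_pos_of_lt_pi (by linarith) (by linarith)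
  have hc : 0 < Real.cos (θ / 2) :=
    Real.cos_pos_of_mem_Ioo ⟨by linarith, by linarith⟩
  have ht : 0 < Real.tan (θ / 2) := by
    rw [Real.tan_eq_sin_div_cos]; positivity
  have hz0 : 0 ≤ z := le_trans (by positivity) hz1
  constructor
  · have h1 := mul_le_mul_of_nonneg_right hz1 ht.le
    have h2 : (3 * w / 2) * (Real.cos (θ / 2) / Real.sin (θ / 2)) * Real.tan (θ / 2)
        = 3 * w / 2 := by
      rw [Real.tan_eq_sin_div_cos]; field_simp
    linarith
  · have hz : z ≤ Real.sqrt (r ^ 2 - (3 * w / 2) ^ 2) := by linarith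
    have hn : 0 ≤ r ^ 2 - (3 * w / 2) ^ 2 := by nlinarith
    have h1 := pow_le_pow_left₀ hz0 hz 2
    rw [Real.sq_sqrt hn] at h1
    have h2 := pow_le_pow_left₀ hd0 hd 2
    linarith
end

section
/- Let θ ∈ (0, π), r > 0, w > 0 with 3w/2 ≤ r, and let Δh satisfy 0 < Δh ≤ √(r² − (3w/2)²) − (3w/2)·cot(θ/2). Then for every horizontal offset d with 0 ≤ d ≤ 3w/2 and every depth z ≥ (3w/2)·cot(θ/2) below the top plane, there exists a level k ∈ ℕ such that the sensor navigating on the plane at depth k·Δh covers the point: setting z' = z − k·Δh, one has z' ≥ 0, d ≤ z'·tan(θ/2) and d² + z'² ≤ r². (This is the completeness guarantee of Proposition 1: with Δh within the stated bound, the layered sensing scheme covers the entire vertical extent of an obstacle face at worst-case horizontal offset at most 3w/2.) -/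
open Real

/-- Proposition 1, completeness of layered sensing: With `θ ∈ (0, π)`,
`r > 0`, `w > 0`, `3w/2 ≤ r` and `0 < Δh ≤ √(r² − (3w/2)²) − (3w/2)·cot(θ/2)`,
every point at horizontal offset `0 ≤ d ≤ 3w/2` and depth `z ≥ (3w/2)·cot(θ/2)`
below the top plane is covered by the sensor navigating on some plane at depth `k·Δh`:
for `z' = z − k·Δh` one has `z' ≥ 0`, `d ≤ z'·tan(θ/2)` and `d² + z'² ≤ r²`. -/
theorem layered_sensing_complete (θ r w Δh d z : ℝ) (hθ : θ ∈ Set.Ioo 0 π) (hr : 0 < r)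
    (hw : 0 < w) (hwr : 3 * w / 2 ≤ r)
    (hΔh0 : 0 < Δh)
    (hΔh : Δh ≤ Real.sqrt (r ^ 2 - (3 * w / 2) ^ 2)
            - (3 * w / 2) * (Real.cos (θ / 2) / Real.sin (θ / 2)))
    (hd0 : 0 ≤ d) (hd : d ≤ 3 * w / 2)
    (hz : (3 * w / 2) * (Real.cos (θ / 2) / Real.sin (θ / 2)) ≤ z) :
    ∃ k : ℕ, 0 ≤ z - k * Δh ∧ d ≤ (z - k * Δh) * Real.tan (θ / 2) ∧
      d ^ 2 + (z - k * Δh) ^ 2 ≤ r ^ 2 := by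
  obtain ⟨h0, h1⟩ := hθ
  have hs : 0 < Real.sin (θ / 2) := Real.sin_pos_of_pos_of_lt_pi (by linarith) (by linarith)
  have hc : 0 < Real.cos (θ / 2) := Real.cos_pos_of_mem_Ioo ⟨by linarith, by linarith⟩
  have ht : 0 < Real.tan (θ / 2) := by
    rw [Real.tan_eq_sin_div_cos]; exact div_pos hs hc
  have hct : (3 * w / 2) * (Real.cos (θ / 2) / Real.sin (θ / 2)) * Real.tan (θ / 2)
      = 3 * w / 2 := by
    rw [Real.tan_eq_sin_div_cos]; field_simp
  have hcpos : 0 < (3 * w / 2) * (Real.cos (θ / 2) / Real.sin (θ / 2)) := by positivity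
  set c := (3 * w / 2) * (Real.cos (θ / 2) / Real.sin (θ / 2)) with hcdef
  have hq : 0 ≤ (z - c) / Δh := div_nonneg (by linarith) hΔh0.le
  have hf1 := Nat.floor_le hq
  have hf2 := Nat.lt_floor_add_one ((z - c) / Δh)
  rw [le_div_iff₀ hΔh0] at hf1
  rw [div_lt_iff₀ hΔh0] at hf2
  have hsq := Real.sq_sqrt (show 0 ≤ r ^ 2 - (3 * w / 2) ^ 2 by nlinarith)
  refine ⟨⌊(z - c) / Δh⌋₊, by linarith, ?_, ?_⟩
  · have := mul_le_mul_of_nonneg_right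
      (show c ≤ z - (⌊(z - c) / Δh⌋₊ : ℝ) * Δh by linarith) ht.le
    linarith
  · have a1 : (z - (⌊(z - c) / Δh⌋₊ : ℝ) * Δh) ^ 2 ≤ Real.sqrt (r ^ 2 - (3 * w / 2) ^ 2) ^ 2 :=
      pow_le_pow_left₀ (by linarith) (by linarith) 2
    have a2 : d ^ 2 ≤ (3 * w / 2) ^ 2 := pow_le_pow_left₀ hd0 hd 2
    linarith
end

section
/- Let n ≥ 1 and let c : Fin n → Fin n → ℝ≥0∞ be an edge-cost function. Define the extended cost ĉ on Fin (n+1) (with dummy vertex n) by: ĉ i j = c i j for i, j < n; ĉ n 0 = 0; ĉ n j = ∞ for 0 < j < n; and ĉ j n = 0 for every j < n. Then the minimum over all Hamiltonian cycles on the n+1 vertices of the total ĉ-cost equals the minimum over all Hamiltonian paths on the n original vertices starting at vertex 0 of the total c-cost; concretely, the infimum over all bijections π : Fin (n+1) → Fin (n+1) with π(0) = n of Σ_{i=0}^{n-1} ĉ(π(i), π(i+1)) + ĉ(π(n), π(0)) equals the infimum over all bijections σ : Fin n → Fin n with σ(0) = 0 of Σ_{i=0}^{n-2} c(σ(i), σ(i+1)).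 -/
open scoped ENNReal

theorem dv_cost (m : ℕ)
    (c : Fin (m+1) → Fin (m+1) → ℝ≥0∞) (cext : Fin (m + 1 + 1) → Fin (m + 1 + 1) → ℝ≥0∞)
    (hmain : ∀ i j : Fin (m+1), cext i.castSucc j.castSucc = c i j)
    (hjd : ∀ j : Fin (m+1), cext j.castSucc (Fin.last (m+1)) = 0)
    (π : Fin (m+1+1) → Fin (m+1+1)) (σ : Fin (m+1) → Fin (m+1))
    (h0 : π 0 = Fin.last (m+1)) (hs : ∀ i : Fin (m+1), π i.succ = (σ i).castSucc) :
    (∑ i : Fin (m+1), cext (π i.castSucc) (π i.succ)) + cext (π (Fin.last (m+1))) (π 0)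
      = cext (Fin.last (m+1)) (σ 0).castSucc
        + ∑ i : Fin m, c (σ i.castSucc) (σ i.succ) := by
  rw [← Fin.succ_last, hs, h0, hjd, add_zero, Fin.sum_univ_succ, Fin.castSucc_zero, h0, hs]
  congr 1
  refine Finset.sum_congr rfl fun i _ => ?_
  rw [← Fin.succ_castSucc, hs, hs, hmain]

/-- dummy-vertex reduction of shortest Hamiltonian path to TSP:
Let `n ≥ 1` and `c : Fin n → Fin n → ℝ≥0∞`. Define the extended cost `ĉ` on `Fin (n+1)`
(with dummy vertex `n`) by `ĉ i j = c i j` for `i, j < n`, `ĉ n 0 = 0`, `ĉ n j = ∞` for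
`0 < j < n`, and `ĉ j n = 0` for `j < n`. Then the infimum over all bijections
`π : Fin (n+1) ≃ Fin (n+1)` with `π 0 = n` of the Hamiltonian-cycle cost
`Σ_{i=0}^{n-1} ĉ(π i, π (i+1)) + ĉ(π n, π 0)` equals the infimum over all bijections
`σ : Fin n ≃ Fin n` with `σ 0 = 0` of the Hamiltonian-path cost
`Σ_{i=0}^{n-2} c(σ i, σ (i+1))`. -/
theorem dummy_vertex_tsp_reduction (n : ℕ) (hn : 1 ≤ n)
    (c : Fin n → Fin n → ℝ≥0∞) (cext : Fin (n + 1) → Fin (n + 1) → ℝ≥0∞)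
    (hmain : ∀ i j : Fin n, cext i.castSucc j.castSucc = c i j)
    (hd0 : cext (Fin.last n) (⟨0, hn⟩ : Fin n).castSucc = 0)
    (hdj : ∀ j : Fin n, 0 < (j : ℕ) → cext (Fin.last n) j.castSucc = ⊤)
    (hjd : ∀ j : Fin n, cext j.castSucc (Fin.last n) = 0) :
    (⨅ π : {π : Equiv.Perm (Fin (n + 1)) // π 0 = Fin.last n},
        (∑ i : Fin n, cext (π.1 i.castSucc) (π.1 i.succ)) +
          cext (π.1 (Fin.last n)) (π.1 0)) =
      ⨅ σ : {σ : Equiv.Perm (Fin n) // σ ⟨0, hn⟩ = ⟨0, hn⟩},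
        ∑ i : Fin (n - 1),
          c (σ.1 ⟨(i : ℕ), by have := i.isLt; omega⟩)
            (σ.1 ⟨(i : ℕ) + 1, by have := i.isLt; omega⟩) := by
  obtain ⟨m, rfl⟩ : ∃ m, n = m + 1 := ⟨n - 1, by omega⟩
  have key := dv_cost m c cext hmain hjd
  apply le_antisymm
  · refine le_iInf fun ⟨σ, hσ⟩ => ?_
    let f : Fin (m+1+1) → Fin (m+1+1) := Fin.cons (Fin.last (m+1)) (fun i => (σ i).castSucc)
    have hf : Function.Injective f := by
      refine Fin.cons_injective_iff.2 ⟨?_, ?_⟩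
      · rintro ⟨i, hi⟩
        exact (Fin.castSucc_lt_last _).ne hi
      · exact (Fin.castSucc_injective _).comp σ.injective
    let π : Equiv.Perm (Fin (m+1+1)) := Equiv.ofBijective f (Finite.injective_iff_bijective.1 hf)
    refine (iInf_le _ ⟨π, rfl⟩).trans (le_of_eq ?_)
    refine (key π σ rfl (fun i => rfl)).trans ?_
    have h2 : σ 0 = ⟨0, hn⟩ := hσ
    rw [h2, hd0, zero_add]
    rfl
  · refine le_iInf fun ⟨π, hπ⟩ => ?_
    have hne : ∀ i : Fin (m+1), π i.succ ≠ Fin.last (m+1) := by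
      intro i h
      exact Fin.succ_ne_zero i (π.injective (h.trans hπ.symm))
    let g : Fin (m+1) → Fin (m+1) := fun i => (π i.succ).castPred (hne i)
    have hg : ∀ i, π i.succ = (g i).castSucc := fun i => (Fin.castSucc_castPred _ _).symm
    have hgi : Function.Injective g := by
      intro i j h
      apply Fin.succ_injective
      apply π.injective
      rw [hg, hg, h]
    let σ : Equiv.Perm (Fin (m+1)) := Equiv.ofBijective g (Finite.injective_iff_bijective.1 hgi)
    refine le_of_le_of_eq ?_ (key π g hπ hg).symm
    by_cases h0 : g 0 = 0
    · refine (iInf_le _ ⟨σ, h0⟩).trans ?_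
      exact le_add_self
    · rw [hdj (g 0) (Nat.pos_of_ne_zero fun h => h0 (Fin.ext h)), top_add]
      exact le_top
end
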